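/- arXiv:2201.08604 — 2 statements merged into one kernel-verified Lean document; each statement's English description precedes it below -/
import Mathlib

section
/- For every γ with 0 < γ < 2 and every x ∈ ℝ, ∫_{−∞}^{∞} (1 − cos(t x)) |t|^{−1−γ} dt = C(γ) |x|^γ, where C(γ) = 2√π Γ(1 − γ/2) / ( γ 2^γ Γ((1+γ)/2) ). -/
open MeasureTheory Real

lemma ew_lint {α : Type*} [MeasurableSpace α] {μ : Measure α} {f : α → ℝ} {I c : ℝ}
    (hc : 0 ≤ c) (hI : 0 < I) (hf : 0 ≤ᵐ[μ] f) (h : ∫ a, f a ∂μ = I) :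
    ∫⁻ a, ENNReal.ofReal (c * f a) ∂μ = ENNReal.ofReal (c * I) := by
  have hi : Integrable f μ := by
    by_contra hn
    rw [integral_undef hn] at h
    exact hI.ne h
  rw [← h, ← integral_const_mul, ofReal_integral_eq_lintegral_ofReal (hi.const_mul c)]
  filter_upwards [hf] with a ha
  exact mul_nonneg hc ha

lemma ew_gauss (s x : ℝ) (hs : 0 < s) :
    ∫ t : ℝ, (1 - Real.cos (t * x)) * Real.exp (-s * t ^ 2)
      = Real.sqrt (π / s) * (1 - Real.exp (-(x ^ 2 / 4 / s))) := by
  have h1 := integral_gaussian s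
  have hi := integrable_exp_neg_mul_sq hs
  have h2 := fourierIntegral_gaussian (b := (s : ℂ)) (by simpa using hs) (x : ℂ)
  have hcint : Integrable fun t : ℝ => Real.cos (t * x) * Real.exp (-s * t ^ 2) := by
    refine hi.mono (by fun_prop) (Filter.Eventually.of_forall fun t => ?_)
    rw [norm_mul]
    exact mul_le_of_le_one_left (norm_nonneg _) (Real.abs_cos_le_one _)
  have hsint : Integrable fun t : ℝ => Real.sin (t * x) * Real.exp (-s * t ^ 2) := by
    refine hi.mono (by fun_prop) (Filter.Eventually.of_forall fun t => ?_)
    rw [norm_mul]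
    exact mul_le_of_le_one_left (norm_nonneg _) (Real.abs_sin_le_one _)
  have h3 : ∫ t : ℝ, Real.cos (t * x) * Real.exp (-s * t ^ 2)
      = Real.sqrt (π / s) * Real.exp (-(x ^ 2 / 4 / s)) := by
    have e1 : ∀ t : ℝ, Complex.exp (Complex.I * x * t) * Complex.exp (-(s:ℂ) * (t:ℂ) ^ 2)
        = ((Real.cos (t * x) * Real.exp (-s * t ^ 2) : ℝ) : ℂ)
          + ((Real.sin (t * x) * Real.exp (-s * t ^ 2) : ℝ) : ℂ) * Complex.I := by
      intro t
      rw [show Complex.I * x * t = (t * x : ℂ) * Complex.I by ring, Complex.exp_mul_I]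
      push_cast
      ring
    simp_rw [e1] at h2
    rw [integral_add hcint.ofReal (hsint.ofReal.mul_const _), integral_mul_const,
      integral_complex_ofReal, integral_complex_ofReal] at h2
    have h4 := congrArg Complex.re h2
    have e2 : ((π : ℂ) / s) ^ (1 / 2 : ℂ) * Complex.exp (-(x:ℂ) ^ 2 / (4 * s))
        = ((Real.sqrt (π / s) * Real.exp (-(x ^ 2 / 4 / s)) : ℝ) : ℂ) := by
      rw [Real.sqrt_eq_rpow]
      push_cast
      rw [Complex.ofReal_cpow (by positivity)]
      push_cast
      congr 2
      field_simp
    rw [e2] at h4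
    rw [Complex.ofReal_re] at h4
    rw [← h4]
    simp
  simp_rw [sub_mul, one_mul]
  rw [integral_sub hi hcint, h1, h3]
  ring

lemma ew_gamma (γ v : ℝ) (hγ2 : γ < 2) (hv : 0 < v) :
    ∫ s in Set.Ioi (0:ℝ), s ^ (γ / 2 - 2) * Real.exp (-(v / s))
      = Real.Gamma (1 - γ / 2) * v ^ (γ / 2 - 1) := by
  have h := integral_comp_rpow_Ioi (fun y : ℝ => y ^ (1 - γ / 2 - 1) * Real.exp (-(v * y)))
    (p := -1) (by norm_num)
  rw [Real.integral_rpow_mul_exp_neg_mul_Ioi (by linarith) hv] at h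
  rw [mul_comm, show v ^ (γ / 2 - 1) = (1 / v) ^ (1 - γ / 2) by
    rw [one_div, Real.inv_rpow hv.le, ← Real.rpow_neg hv.le]; ring_nf, ← h]
  refine setIntegral_congr_fun measurableSet_Ioi fun s hs => ?_
  have hs : 0 < s := hs
  simp only [smul_eq_mul]
  rw [← Real.rpow_mul hs.le, Real.rpow_neg_one, abs_neg, abs_one, one_mul, ← mul_assoc,
    ← Real.rpow_add hs, div_eq_mul_inv v s]
  ring_nf

lemma ew_exp (s a : ℝ) (hs : 0 < s) (ha : 0 < a) :
    ∫ v in Set.Ioc (0:ℝ) a, s⁻¹ * Real.exp (-(v / s)) = 1 - Real.exp (-(a / s)) := by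
  rw [← intervalIntegral.integral_of_le ha.le]
  rw [intervalIntegral.integral_eq_sub_of_hasDerivAt (f := fun v => - Real.exp (-(v / s)))]
  · simp; ring
  · intro v _
    have := (((hasDerivAt_id v).div_const s).neg.exp).neg
    have e : s⁻¹ * Real.exp (-(v / s)) = -(Real.exp (-(v / s)) * -(1 / s)) := by
      rw [one_div]; ring
    rw [e]
    exact this
  · exact Continuous.intervalIntegrable (by fun_prop) _ _

lemma ew_pow (γ a : ℝ) (hγ0 : 0 < γ) (ha : 0 < a) :
    ∫ v in Set.Ioc (0:ℝ) a, v ^ (γ / 2 - 1) = a ^ (γ / 2) / (γ / 2) := by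
  rw [← intervalIntegral.integral_of_le ha.le, integral_rpow (Or.inl (by linarith))]
  rw [sub_add_cancel, Real.zero_rpow (by positivity), sub_zero]

lemma ew_sub (γ t : ℝ) (hγ0 : 0 < γ) (ht : t ≠ 0) :
    ∫ s in Set.Ioi (0:ℝ), s ^ ((1 + γ) / 2 - 1) * Real.exp (-s * t ^ 2)
      = Real.Gamma ((1 + γ) / 2) * |t| ^ (-1 - γ) := by
  have h := Real.integral_rpow_mul_exp_neg_mul_Ioi (a := (1 + γ) / 2) (r := t ^ 2)
    (by positivity) (by positivity)
  rw [mul_comm (Real.Gamma _), show |t| ^ (-1 - γ) = (1 / t ^ 2) ^ ((1 + γ) / 2) by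
    rw [one_div, Real.inv_rpow (by positivity), ← Real.rpow_neg (by positivity), ← sq_abs,
      ← Real.rpow_natCast, ← Real.rpow_mul (abs_nonneg _)]
    congr 1; push_cast; ring, ← h]
  congr 1; ext s; ring_nf

lemma ew_main (γ : ℝ) (hγ0 : 0 < γ) (hγ2 : γ < 2) (x : ℝ) (hx : x ≠ 0) :
    ∫⁻ t : ℝ, ENNReal.ofReal ((1 - Real.cos (t * x)) * |t| ^ (-1 - γ)) =
      ENNReal.ofReal ((Real.Gamma ((1 + γ) / 2))⁻¹ * √π * Real.Gamma (1 - γ / 2) *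
        ((x ^ 2 / 4) ^ (γ / 2) / (γ / 2))) := by
  set G := Real.Gamma ((1 + γ) / 2) with hG
  have hGp : 0 < G := Real.Gamma_pos_of_pos (by positivity)
  have hHp : 0 < Real.Gamma (1 - γ / 2) := Real.Gamma_pos_of_pos (by linarith)
  have ha : 0 < x ^ 2 / 4 := by positivity
  have hcos : ∀ t, 0 ≤ 1 - Real.cos t := fun t => by linarith [Real.cos_le_one t]
  calc
    _ = ∫⁻ t : ℝ, ∫⁻ s in Set.Ioi (0:ℝ), ENNReal.ofReal ((1 - Real.cos (t * x)) * G⁻¹ *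
          (s ^ ((1 + γ) / 2 - 1) * Real.exp (-s * t ^ 2))) := by
      refine lintegral_congr_ae ?_
      have : ∀ᵐ t : ℝ, t ≠ 0 := by simp [ae_iff]
      filter_upwards [this] with t ht
      rw [ew_lint (mul_nonneg (hcos _) (by positivity)) ?_ ?_ (ew_sub γ t hγ0 ht)]
      · rw [← hG]; congr 1; field_simp
      · positivity
      · filter_upwards [ae_restrict_mem measurableSet_Ioi] with s hs
        have hs : 0 < s := hs
        simp only [Pi.zero_apply]; positivity
    _ = ∫⁻ s in Set.Ioi (0:ℝ), ∫⁻ t : ℝ, ENNReal.ofReal ((1 - Real.cos (t * x)) * G⁻¹ *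
          (s ^ ((1 + γ) / 2 - 1) * Real.exp (-s * t ^ 2))) := by
      refine lintegral_lintegral_swap (Measurable.aemeasurable ?_)
      simp only [Function.uncurry_def]; fun_prop
    _ = ∫⁻ s in Set.Ioi (0:ℝ), ∫⁻ v in Set.Ioc (0:ℝ) (x ^ 2 / 4),
          ENNReal.ofReal ((G⁻¹ * √π) * (s ^ (γ / 2 - 2) * Real.exp (-(v / s)))) := by
      refine setLIntegral_congr_fun measurableSet_Ioi fun s hs => ?_
      have hs : 0 < s := hs
      have hlt : 0 < 1 - Real.exp (-(x ^ 2 / 4 / s)) := by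
        have : Real.exp (-(x ^ 2 / 4 / s)) < 1 := (by rw [← Real.exp_zero]; exact Real.exp_lt_exp.mpr (by
          have : 0 < x ^ 2 / 4 / s := by positivity
          linarith))
        linarith
      have k1 := ew_lint (c := G⁻¹ * s ^ ((1 + γ) / 2 - 1)) (by positivity) (by positivity)
        (Filter.Eventually.of_forall fun t => mul_nonneg (hcos _) (by positivity))
        (ew_gauss s x hs)
      have k2 := ew_lint (c := G⁻¹ * √π * s ^ (γ / 2 - 1)) (by positivity) hlt
        (Filter.Eventually.of_forall fun t => by simp only [Pi.zero_apply]; positivity)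
        (ew_exp s (x ^ 2 / 4) hs ha)
      have k3 : G⁻¹ * s ^ ((1 + γ) / 2 - 1) * (√(π / s) * (1 - Real.exp (-(x ^ 2 / 4 / s))))
          = G⁻¹ * √π * s ^ (γ / 2 - 1) * (1 - Real.exp (-(x ^ 2 / 4 / s))) := by
        rw [Real.sqrt_div pi_pos.le, Real.sqrt_eq_rpow s, div_eq_mul_inv (√π), ← Real.rpow_neg hs.le,
          show γ / 2 - 1 = ((1 + γ) / 2 - 1) + -(1 / 2) by ring, Real.rpow_add hs]
        ring
      rw [k3, ← k2] at k1
      have k4 : s ^ (γ / 2 - 2) = s ^ (γ / 2 - 1) * s⁻¹ := by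
        rw [← Real.rpow_neg_one s, ← Real.rpow_add hs]; ring_nf
      simp only [k4]
      convert k1 using 4
      · ring
      · ring
    _ = ∫⁻ v in Set.Ioc (0:ℝ) (x ^ 2 / 4), ∫⁻ s in Set.Ioi (0:ℝ),
          ENNReal.ofReal ((G⁻¹ * √π) * (s ^ (γ / 2 - 2) * Real.exp (-(v / s)))) := by
      refine lintegral_lintegral_swap (Measurable.aemeasurable ?_)
      simp only [Function.uncurry_def]; fun_prop
    _ = ∫⁻ v in Set.Ioc (0:ℝ) (x ^ 2 / 4),
          ENNReal.ofReal ((G⁻¹ * √π * Real.Gamma (1 - γ / 2)) * v ^ (γ / 2 - 1)) := by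
      refine setLIntegral_congr_fun measurableSet_Ioc fun v hv => ?_
      have hv : 0 < v := hv.1
      rw [ew_lint (by positivity) (by positivity) ?_ (ew_gamma γ v hγ2 hv), mul_assoc (G⁻¹ * √π)]
      filter_upwards [ae_restrict_mem measurableSet_Ioi] with s hs
      have hs : 0 < s := hs
      simp only [Pi.zero_apply]; positivity
    _ = _ := by
      rw [ew_lint (by positivity) (by positivity) ?_ (ew_pow γ _ hγ0 ha)]
      filter_upwards [ae_restrict_mem measurableSet_Ioc] with s hs
      have hs : 0 < s := hs.1
      simp only [Pi.zero_apply]; positivity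

/-- For `0 < γ < 2` and `x ∈ ℝ`,
`∫ (1 − cos(tx)) |t|^{−1−γ} dt = C(γ) |x|^γ` with
`C(γ) = 2√π Γ(1 − γ/2) / (γ 2^γ Γ((1+γ)/2))`. -/
theorem energy_weight_integral (γ : ℝ) (hγ0 : 0 < γ) (hγ2 : γ < 2) (x : ℝ) :
    ∫ t : ℝ, (1 - Real.cos (t * x)) * |t| ^ (-1 - γ) =
      (2 * Real.sqrt π * Real.Gamma (1 - γ / 2) /
        (γ * (2 : ℝ) ^ γ * Real.Gamma ((1 + γ) / 2))) * |x| ^ γ := by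
  rcases eq_or_ne x 0 with rfl | hx
  · simp [Real.zero_rpow hγ0.ne']
  have hGp : 0 < Real.Gamma ((1 + γ) / 2) := Real.Gamma_pos_of_pos (by positivity)
  have hHp : 0 < Real.Gamma (1 - γ / 2) := Real.Gamma_pos_of_pos (by linarith)
  rw [integral_eq_lintegral_of_nonneg_ae, ew_main γ hγ0 hγ2 x hx,
    ENNReal.toReal_ofReal (by positivity)]
  · have : (x ^ 2 / 4) ^ (γ / 2) = |x| ^ γ / 2 ^ γ := by
      rw [show x ^ 2 / 4 = (|x| / 2) ^ (2:ℝ) by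
        rw [Real.rpow_two, div_pow, sq_abs]; norm_num, ← Real.rpow_mul (by positivity),
        mul_div_cancel₀ _ (by norm_num), Real.div_rpow (abs_nonneg _) (by norm_num)]
    rw [this]
    field_simp
  · exact Filter.Eventually.of_forall fun t =>
      mul_nonneg (by linarith [Real.cos_le_one (t * x)]) (by positivity)
  · exact Measurable.aestronglyMeasurable (by fun_prop)
end

section
/- Let X be a standard normal random variable, 0 < γ < 2, and x ∈ ℝ. Then E|x − X|^γ = (2^{γ/2}/√π) Γ((1+γ)/2) e^{-x²/2} ∑_{k=0}^{∞} ( ((1+γ)/2)_k / ( (1/2)_k · k! ) ) (x²/2)^k, where (a)_k = a(a+1)⋯(a+k−1) denotes the rising factorial (Pochhammer symbol) with (a)_0 = 1; i.e., the right-hand side equals (2^{γ/2}/√π) Γ((1+γ)/2) e^{-x²/2} · ₁F₁((1+γ)/2, 1/2, x²/2). -/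
open MeasureTheory ProbabilityTheory Real

lemma aux_poch_pos (a : ℝ) (ha : 0 < a) (k : ℕ) : 0 < (ascPochhammer ℝ k).eval a :=
  ascPochhammer_pos k a ha

lemma aux_gamma (a : ℝ) (ha : 0 < a) (k : ℕ) :
    Real.Gamma (a + k) = (ascPochhammer ℝ k).eval a * Real.Gamma a := by
  induction k with
  | zero => simp
  | succ k ih =>
    rw [ascPochhammer_succ_eval, Nat.cast_succ, ← add_assoc, Real.Gamma_add_one (by positivity), ih]
    ring

lemma aux_fact (k : ℕ) :
    (Nat.factorial (2 * k) : ℝ) = 4 ^ k * k.factorial * (ascPochhammer ℝ k).eval (1 / 2) := by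
  induction k with
  | zero => simp
  | succ k ih =>
    rw [ascPochhammer_succ_eval, show 2 * (k + 1) = 2 * k + 1 + 1 by ring, Nat.factorial_succ,
      Nat.factorial_succ, Nat.factorial_succ]
    push_cast
    rw [ih]
    ring

lemma aux_le (a : ℝ) (ha : 0 < a) (ha' : a ≤ 3 / 2) (k : ℕ) :
    (ascPochhammer ℝ k).eval a ≤ 3 ^ k * (ascPochhammer ℝ k).eval (1 / 2) := by
  induction k with
  | zero => simp
  | succ k ih =>
    rw [ascPochhammer_succ_eval, ascPochhammer_succ_eval]
    have h0 := aux_poch_pos (1 / 2) (by norm_num) k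
    have hk : (0 : ℝ) ≤ k := by positivity
    calc _ ≤ (3 ^ k * (ascPochhammer ℝ k).eval (1 / 2)) * (3 * (1 / 2 + k)) := by
            apply mul_le_mul ih (by linarith) (by positivity) (by positivity)
      _ = _ := by ring

lemma aux_summable (a : ℝ) (ha : 0 < a) (ha' : a ≤ 3 / 2) (z : ℝ) (hz : 0 ≤ z) :
    Summable fun k : ℕ => ((ascPochhammer ℝ k).eval a /
            ((ascPochhammer ℝ k).eval (1 / 2) * (Nat.factorial k : ℝ))) * z ^ k := by
  refine Summable.of_nonneg_of_le (fun k => ?_) (fun k => ?_) (Real.summable_pow_div_factorial (3 * z))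
  · have := aux_poch_pos (1 / 2) (by norm_num) k
    have := aux_poch_pos a ha k
    positivity
  · have h0 := aux_poch_pos (1 / 2) (by norm_num) k
    have h1 := aux_le a ha ha' k
    calc _ ≤ (3 ^ k * (ascPochhammer ℝ k).eval (1 / 2) /
            ((ascPochhammer ℝ k).eval (1 / 2) * (Nat.factorial k : ℝ))) * z ^ k := by gcongr
      _ = _ := by rw [mul_pow]; field_simp

lemma aux_term (γ : ℝ) (hγ0 : 0 < γ) (x : ℝ) (k : ℕ) :
    IntegrableOn (fun t : ℝ => t ^ γ * rexp (-t ^ 2 / 2) * ((x * t) ^ (2 * k) / (2 * k).factorial))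
      (Set.Ioi 0) ∧
    ∫ t in Set.Ioi (0 : ℝ), t ^ γ * rexp (-t ^ 2 / 2) * ((x * t) ^ (2 * k) / (2 * k).factorial) =
      (2 : ℝ) ^ ((1 + γ) / 2) / 2 * Real.Gamma ((1 + γ) / 2) *
        (((ascPochhammer ℝ k).eval ((1 + γ) / 2) /
            ((ascPochhammer ℝ k).eval (1 / 2) * (Nat.factorial k : ℝ))) * (x ^ 2 / 2) ^ k) := by
  have hq : (-1 : ℝ) < γ + 2 * k := by have : (0 : ℝ) ≤ k := by positivity
                                       linarith
  have hE : Set.EqOn (fun t : ℝ => x ^ (2 * k) / (2 * k).factorial *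
      (t ^ (γ + 2 * k) * rexp (-(1 / 2) * t ^ (2 : ℝ))))
      (fun t : ℝ => t ^ γ * rexp (-t ^ 2 / 2) * ((x * t) ^ (2 * k) / (2 * k).factorial))
      (Set.Ioi 0) := by
    intro t ht
    have ht : 0 < t := ht
    have e1 : t ^ (γ + 2 * k) = t ^ γ * t ^ (2 * k) := by
      rw [rpow_add ht, ← rpow_natCast t (2 * k)]; push_cast; rfl
    have e2 : -(1 / 2) * t ^ (2 : ℝ) = -t ^ 2 / 2 := by
      rw [rpow_two]; ring
    simp only [e1, e2, mul_pow]
    ring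
  constructor
  · exact IntegrableOn.congr_fun
      ((integrableOn_rpow_mul_exp_neg_mul_rpow hq two_pos (by norm_num : (0 : ℝ) < 1 / 2)).const_mul _)
      hE measurableSet_Ioi
  · rw [← setIntegral_congr_fun measurableSet_Ioi hE, integral_const_mul,
      integral_rpow_mul_exp_neg_mul_rpow two_pos hq (by norm_num)]
    have e3 : (γ + 2 * k + 1) / 2 = (1 + γ) / 2 + k := by ring
    have e4 : -(γ + 2 * k + 1) / 2 = -((1 + γ) / 2 + k) := by ring
    rw [e3, e4, aux_gamma _ (by positivity), aux_fact, one_div, ← rpow_neg_eq_inv_rpow, neg_neg,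
      rpow_add two_pos, rpow_natCast]
    have h0 := (aux_poch_pos (1 / 2) (by norm_num) k).ne'
    rw [show (4 : ℝ) = 2 ^ 2 by norm_num, div_pow, pow_mul, ← pow_mul 2, two_mul, pow_add]
    rw [one_div] at *
    field_simp

lemma aux_half (γ : ℝ) (hγ0 : 0 < γ) (hγ2 : γ < 2) (x : ℝ) :
    ∫ t in Set.Ioi (0 : ℝ), t ^ γ * rexp (-t ^ 2 / 2) * Real.cosh (x * t) =
      (2 : ℝ) ^ ((1 + γ) / 2) / 2 * Real.Gamma ((1 + γ) / 2) *
        ∑' k : ℕ, (((ascPochhammer ℝ k).eval ((1 + γ) / 2) /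
            ((ascPochhammer ℝ k).eval (1 / 2) * (Nat.factorial k : ℝ))) * (x ^ 2 / 2) ^ k) := by
  have hs := aux_summable ((1 + γ) / 2) (by positivity) (by linarith) (x ^ 2 / 2) (by positivity)
  have h := hasSum_integral_of_summable_integral_norm
    (fun k => (aux_term γ hγ0 x k).1) (by
      refine (hs.mul_left ((2 : ℝ) ^ ((1 + γ) / 2) / 2 * Real.Gamma ((1 + γ) / 2))).congr
        fun k => ?_
      rw [← (aux_term γ hγ0 x k).2]
      refine setIntegral_congr_fun measurableSet_Ioi fun t ht => ?_
      have ht : 0 < t := ht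
      have : 0 ≤ (x * t) ^ (2 * k) := by rw [pow_mul]; positivity
      exact (Real.norm_of_nonneg (by positivity)).symm)
  simp only [(aux_term γ hγ0 x _).2, tsum_mul_left, ← Real.cosh_eq_tsum] at h
  rw [← h.tsum_eq, tsum_mul_left]



/-- For `X` standard normal, `0 < γ < 2` and `x ∈ ℝ`,
`E|x − X|^γ = (2^{γ/2}/√π) Γ((1+γ)/2) e^{−x²/2} ∑ₖ ((1+γ)/2)ₖ/((1/2)ₖ k!) (x²/2)^k`,
i.e. the right-hand side is `(2^{γ/2}/√π) Γ((1+γ)/2) e^{−x²/2} ₁F₁((1+γ)/2, 1/2, x²/2)`,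
where `(a)ₖ` is the rising factorial (`ascPochhammer`). -/
theorem energy_normal_moment_kummer (γ : ℝ) (hγ0 : 0 < γ) (hγ2 : γ < 2) (x : ℝ) :
    ∫ y : ℝ, |x - y| ^ γ ∂(gaussianReal 0 1) =
      ((2 : ℝ) ^ (γ / 2) / Real.sqrt π) * Real.Gamma ((1 + γ) / 2) *
        Real.exp (-x ^ 2 / 2) *
        ∑' k : ℕ, ((ascPochhammer ℝ k).eval ((1 + γ) / 2) /
            ((ascPochhammer ℝ k).eval (1 / 2) * (Nat.factorial k : ℝ))) *
          (x ^ 2 / 2) ^ k := by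
  set C : ℝ := (√(2 * π))⁻¹ with hC
  have hint : Integrable (fun y : ℝ => |x - y| ^ γ) (gaussianReal 0 1) := by
    have h1 : MemLp (fun y : ℝ => x - y) (ENNReal.ofReal γ) (gaussianReal 0 1) :=
      (memLp_const x).sub (memLp_id_gaussianReal' _ ENNReal.ofReal_ne_top)
    have := h1.integrable_norm_rpow'
    simpa [ENNReal.toReal_ofReal hγ0.le] using this
  rw [gaussianReal_of_var_ne_zero _ one_ne_zero,
    integrable_withDensity_iff_integrable_smul' (measurable_gaussianPDF _ _)
      (ae_of_all _ fun _ ↦ gaussianPDF_lt_top)] at hint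
  simp only [toReal_gaussianPDF] at hint
  rw [integral_gaussianReal_eq_integral_smul one_ne_zero]
  have hint2 := hint.comp_sub_left x
  rw [← integral_sub_left_eq_self _ volume x]
  set h : ℝ → ℝ := fun u => gaussianPDFReal 0 1 (x - u) • |x - (x - u)| ^ γ with hh
  have hneg : ∫ u, h (-u) = ∫ u, h u := integral_neg_eq_self h volume
  have hsum : ∫ u, (h u + h (-u)) = 2 * ∫ u, h u := by
    rw [integral_add hint2 hint2.comp_neg, hneg]; ring
  have hpt : ∀ u, h u + h (-u) =
      2 * C * rexp (-x ^ 2 / 2) * (|u| ^ γ * rexp (-|u| ^ 2 / 2) * Real.cosh (x * |u|)) := by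
    intro u
    have hc : Real.cosh (x * |u|) = Real.cosh (x * u) := by
      rcases abs_cases u with ⟨h, _⟩ | ⟨h, _⟩ <;> simp [h]
    have e1 : rexp (-(x - u) ^ 2 / 2) = rexp (-x ^ 2 / 2) * rexp (-u ^ 2 / 2) * rexp (x * u) := by
      rw [← Real.exp_add, ← Real.exp_add]; ring_nf
    have e2 : rexp (-(x + u) ^ 2 / 2) =
        rexp (-x ^ 2 / 2) * rexp (-u ^ 2 / 2) * rexp (-(x * u)) := by
      rw [← Real.exp_add, ← Real.exp_add]; ring_nf
    rw [hc, Real.cosh_eq, sq_abs]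
    simp only [hh, gaussianPDFReal, sub_sub_cancel, abs_neg, smul_eq_mul, sub_zero, sub_neg_eq_add,
      NNReal.coe_one, mul_one, e1, e2, ← hC]
    ring
  have hI := integral_comp_abs (f := fun t : ℝ => t ^ γ * rexp (-t ^ 2 / 2) * Real.cosh (x * t))
  simp only [hpt] at hsum
  rw [integral_const_mul, hI, aux_half γ hγ0 hγ2] at hsum
  have hpow : (2 : ℝ) ^ ((1 + γ) / 2) * C = 2 ^ (γ / 2) / √π := by
    rw [hC, Real.sqrt_mul (by norm_num), add_div, rpow_add two_pos, ← Real.sqrt_eq_rpow]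
    have : √(2 : ℝ) ≠ 0 := by positivity
    field_simp
  rw [← hpow]
  linear_combination (-1 / 2) * hsum
end
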